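/- The expected number of fixed points of a uniformly random 123-avoiding permutation of size n tends to 1/2: lim_{n→∞} (1/C_n) · Σ_{σ ∈ S_n(123)} fp(σ) = 1/2. -/

import Mathlib

open Filter Finset Real

/-- `σ` contains the pattern `τ`. -/
def ContainsPattern {n m : ℕ} (σ : Equiv.Perm (Fin n)) (τ : Equiv.Perm (Fin m)) : Prop :=
  ∃ f : Fin m → Fin n, StrictMono f ∧ ∀ a b : Fin m, σ (f a) < σ (f b) ↔ τ a < τ b

/-- `σ` avoids the pattern `τ`. -/
def Avoids {n m : ℕ} (σ : Equiv.Perm (Fin n)) (τ : Equiv.Perm (Fin m)) : Prop :=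
  ¬ ContainsPattern σ τ

/-- The pattern (1,2,3) ∈ S₃ (0-indexed: 0,1,2). -/
def pattern123 : Equiv.Perm (Fin 3) := 1

/-- The pattern (1,3,2) ∈ S₃ (0-indexed: 0,2,1). -/
def pattern132 : Equiv.Perm (Fin 3) := Equiv.swap 1 2

/-- The pattern (3,2,1) ∈ S₃ (0-indexed: 2,1,0). -/
def pattern321 : Equiv.Perm (Fin 3) := Equiv.swap 0 2

/-- The pattern (2,3,1) ∈ S₃ (0-indexed: 1,2,0). -/
def pattern231 : Equiv.Perm (Fin 3) := (Equiv.swap 1 2).trans (Equiv.swap 0 1)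

/-- The number of fixed points of a permutation. -/
def fpCount {n : ℕ} (σ : Equiv.Perm (Fin n)) : ℕ :=
  (Finset.univ.filter (fun i : Fin n => σ i = i)).card

attribute [local instance] Classical.propDecidable


/-- Good words. -/
def Good {k i : ℕ} (α : Fin i → Fin k) : Prop :=
  Function.Injective α ∧ ∀ p q, p < q → α p < α q → ∀ y, α q < y → ∃ r, r < q ∧ α r = y

open Classical in
/-- Number of good words. -/
noncomputable def NN (k i : ℕ) : ℕ := (Finset.univ.filter (fun α : Fin i → Fin k => Good α)).card

lemma good_succ {k i : ℕ} (α : Fin i → Fin k) :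
    Good (fun p => (α p).succ) ↔ Good α := by
  constructor
  · rintro ⟨h1, h2⟩
    refine ⟨fun a b h => h1 (by simp [h]), fun p q hpq h y hy => ?_⟩
    obtain ⟨r, hr, e⟩ := h2 p q hpq (by simpa using h) y.succ (by simpa using hy)
    exact ⟨r, hr, by simpa using e⟩
  · rintro ⟨h1, h2⟩
    refine ⟨fun a b h => h1 (by simpa using h), fun p q hpq h y hy => ?_⟩
    have hy0 : y ≠ 0 := by rintro rfl; simp at hy
    obtain ⟨z, rfl⟩ := Fin.exists_succ_eq.2 hy0
    obtain ⟨r, hr, e⟩ := h2 p q hpq (by simpa using h) z (by simpa using hy)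
    exact ⟨r, hr, by simpa using e⟩

lemma good_snoc {k i : ℕ} (w : Fin i → Fin k) (v : Fin k) (hw : Good w)
    (hv : ∀ p, w p ≠ v) (h : ∀ p, w p < v → ∀ y, v < y → ∃ r, w r = y) :
    Good (Fin.snoc w v : Fin (i + 1) → Fin k) := by
  constructor
  · intro a b
    induction a using Fin.lastCases with
    | last =>
      induction b using Fin.lastCases with
      | last => simp
      | cast b => simp only [Fin.snoc_last, Fin.snoc_castSucc]; intro e; exact absurd e.symm (hv b)
    | cast a =>
      induction b using Fin.lastCases with
      | last => simp only [Fin.snoc_last, Fin.snoc_castSucc]; intro e; exact absurd e (hv a)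
      | cast b => simp only [Fin.snoc_castSucc]; intro e; rw [hw.1 e]
  · intro p q hpq
    induction p using Fin.lastCases with
    | last => exact absurd hpq (not_lt.2 (Fin.le_last q))
    | cast p =>
      induction q using Fin.lastCases with
      | last =>
        simp only [Fin.snoc_last, Fin.snoc_castSucc]
        intro e y hy
        obtain ⟨r, hr⟩ := h p e y hy
        exact ⟨r.castSucc, Fin.castSucc_lt_last r, by simpa using hr⟩
      | cast q =>
        simp only [Fin.snoc_castSucc]
        intro e y hy
        obtain ⟨r, hr, e⟩ := hw.2 p q (by simpa using hpq) e y hy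
        exact ⟨r.castSucc, by simpa using hr, by simpa using e⟩

lemma good_init {k i : ℕ} (α : Fin (i + 1) → Fin k) (hα : Good α) :
    Good (fun p : Fin i => α p.castSucc) := by
  constructor
  · intro a b h
    exact Fin.castSucc_injective _ (hα.1 h)
  · intro p q hpq e y hy
    obtain ⟨r, hr, e⟩ := hα.2 p.castSucc q.castSucc (by simpa using hpq) e y hy
    have : r ≠ Fin.last i := by
      rintro rfl
      exact absurd hr (not_lt.2 (Fin.le_last _))
    obtain ⟨r', rfl⟩ := Fin.exists_castSucc_eq.2 this
    exact ⟨r', by simpa using hr, e⟩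

lemma good_last_aux {k i : ℕ} (α β : Fin (i + 1) → Fin (k + 1)) (hα : Good α) (hβ : Good β)
    (h : ∀ p : Fin i, α p.castSucc = β p.castSucc) (p : Fin i) (hp : α p.castSucc = 0) :
    ¬ α (Fin.last i) < β (Fin.last i) := by
  intro hlt
  have h0 : α p.castSucc < α (Fin.last i) := by
    rw [hp, Fin.pos_iff_ne_zero, ← hp]
    intro e
    exact absurd (hα.1 e) (Fin.castSucc_lt_last p).ne'
  obtain ⟨r, hr, e⟩ := hα.2 _ _ (Fin.castSucc_lt_last p) h0 _ hlt
  obtain ⟨r', rfl⟩ := Fin.exists_castSucc_eq.2 hr.ne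
  rw [h r'] at e
  exact absurd (hβ.1 e) hr.ne

lemma NN_rec (k i : ℕ) (hik : i ≤ k) : NN (k + 1) (i + 1) = NN k (i + 1) + NN (k + 1) i := by
  classical
  unfold NN
  rw [← Finset.card_filter_add_card_filter_not (fun α : Fin (i + 1) → Fin (k + 1) => ∀ p, α p ≠ 0)]
  congr 1
  · symm
    apply Finset.card_bij (fun α _ => fun p => (α p).succ)
    · intro α hα
      simp only [Finset.mem_filter, Finset.mem_univ, true_and] at hα ⊢
      exact ⟨(good_succ α).2 hα, fun p => Fin.succ_ne_zero _⟩
    · intro α _ β _ h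
      funext p
      simpa using congrFun h p
    · intro β hβ
      simp only [Finset.mem_filter, Finset.mem_univ, true_and] at hβ ⊢
      have : β = fun p => ((β p).pred (hβ.2 p)).succ := by funext p; simp
      refine ⟨fun p => (β p).pred (hβ.2 p), ?_, this.symm⟩
      rw [← good_succ, ← this]
      exact hβ.1
  · apply Finset.card_bij (fun α _ => fun p : Fin i => α p.castSucc)
    · intro α hα
      simp only [Finset.mem_filter, Finset.mem_univ, true_and] at hα ⊢
      exact good_init α hα.1
    · intro α hα β hβ h
      simp only [Finset.mem_filter, Finset.mem_univ, true_and, not_forall, not_not] at hα hβ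
      have h' : ∀ p : Fin i, α p.castSucc = β p.castSucc := fun p => congrFun h p
      have hl : α (Fin.last i) = β (Fin.last i) := by
        by_cases hz : ∃ p : Fin i, α p.castSucc = 0
        · obtain ⟨p, hp⟩ := hz
          apply le_antisymm
          · exact not_lt.1 (good_last_aux β α hβ.1 hα.1 (fun p => (h' p).symm) p (by rw [← h' p, hp]))
          · exact not_lt.1 (good_last_aux α β hα.1 hβ.1 h' p hp)
        · obtain ⟨⟨p, hp⟩, ⟨q, hq⟩⟩ := And.intro hα.2 hβ.2
          have e1 : p = Fin.last i := by
            by_contra hc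
            obtain ⟨r', rfl⟩ := Fin.exists_castSucc_eq.2 hc
            exact hz ⟨r', hp⟩
          have e2 : q = Fin.last i := by
            by_contra hc
            obtain ⟨r', rfl⟩ := Fin.exists_castSucc_eq.2 hc
            exact hz ⟨r', by rw [h', hq]⟩
          rw [← e1, hp, e1, ← e2, hq]
      funext p
      induction p using Fin.lastCases with
      | last => exact hl
      | cast p => exact h' p
    · intro w hw
      simp only [Finset.mem_filter, Finset.mem_univ, true_and, not_forall, not_not] at hw ⊢
      suffices H : ∃ α : Fin (i + 1) → Fin (k + 1), (Good α ∧ ∃ p, α p = 0) ∧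
          (fun p : Fin i => α p.castSucc) = w by
        obtain ⟨α, h1, h2⟩ := H
        exact ⟨α, h1, h2⟩
      by_cases hz : ∃ p, w p = 0
      · have hne : (Finset.univ \ Finset.univ.image w).Nonempty := by
          rw [← Finset.card_pos]
          have h1 := Finset.le_card_sdiff (Finset.univ.image w) (Finset.univ : Finset (Fin (k+1)))
          have h2 := Finset.card_image_le (s := (Finset.univ : Finset (Fin i))) (f := w)
          simp only [Finset.card_univ, Fintype.card_fin] at h1 h2
          omega
        have hm := Finset.max'_mem _ hne
        have hmax := Finset.le_max' (Finset.univ \ Finset.univ.image w)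
        set m := (Finset.univ \ Finset.univ.image w).max' hne
        simp only [Finset.mem_sdiff, Finset.mem_univ, true_and, Finset.mem_image, not_exists] at hm hmax
        obtain ⟨p, hp⟩ := hz
        refine ⟨Fin.snoc w m, ⟨good_snoc w m hw hm ?_, p.castSucc, by simpa using hp⟩, by simp⟩
        intro _ _ y hy
        by_contra hc
        push Not at hc
        exact absurd hy (not_lt.2 (hmax y hc))
      · push Not at hz
        refine ⟨Fin.snoc w 0, ⟨good_snoc w 0 hw hz ?_, Fin.last i, by simp⟩, by simp⟩
        intro p hp
        simp at hp

lemma NN_zero (k : ℕ) : NN k 0 = 1 := by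
  classical
  unfold NN
  rw [Finset.filter_true_of_mem]
  · simp
  · intro α _
    exact ⟨fun a => a.elim0, fun a => a.elim0⟩

lemma NN_zero_left (i : ℕ) : NN 0 (i + 1) = 0 := by
  classical
  unfold NN
  rw [Finset.card_eq_zero, Finset.filter_eq_empty_iff]
  intro α
  exact (α 0).elim0

lemma NN_big (k i : ℕ) (h : k < i) : NN k i = 0 := by
  classical
  unfold NN
  rw [Finset.card_eq_zero, Finset.filter_eq_empty_iff]
  intro α _ hα
  have := Fintype.card_le_of_injective α hα.1
  simp at this
  omega

lemma NN_formula (k : ℕ) : ∀ i, i ≤ k →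
    NN k (i + 1) + (k + i + 1).choose i = (k + i + 1).choose (i + 1) := by
  induction k with
  | zero =>
    intro i hi
    obtain rfl : i = 0 := by omega
    rw [NN_zero_left]; simp
  | succ k ih =>
    intro i
    induction i with
    | zero =>
      intro _
      have := ih 0 (by omega)
      rw [NN_rec k 0 (by omega), NN_zero]
      simp at this ⊢
      omega
    | succ i ih2 =>
      intro hi
      rcases Nat.lt_or_ge k (i + 1) with hc | hc
      · obtain rfl : i = k := by omega
        rw [NN_big _ _ (by omega), zero_add]
        exact Nat.choose_symm_of_eq_add (by ring)
      · have h1 := ih (i + 1) hc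
        have h2 := ih2 (by omega)
        rw [NN_rec k (i + 1) (by omega)]
        have e1 : k + 1 + (i + 1) + 1 = (k + (i + 1) + 1) + 1 := by ring
        have e2 : k + 1 + i + 1 = (k + (i + 1) + 1) := by ring
        rw [e2] at h2
        clear e2
        rw [e1, Nat.choose_succ_succ' _ i, Nat.choose_succ_succ' _ (i+1)]
        omega

lemma avoids_iff {n : ℕ} (σ : Equiv.Perm (Fin n)) :
    Avoids σ pattern123 ↔ ∀ a b c, a < b → b < c → σ a < σ b → σ b < σ c → False := by
  unfold Avoids ContainsPattern pattern123
  constructor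
  · intro h a b c hab hbc h1 h2
    apply h
    refine ⟨![a, b, c], ?_, ?_⟩
    · rw [Fin.strictMono_iff_lt_succ]
      intro i
      fin_cases i
      · exact hab
      · exact hbc
    · have h3 := h1.trans h2
      intro x y
      fin_cases x <;> fin_cases y <;> simp [h1, h2, h3, h1.le, h2.le, h3.le]
  · rintro h ⟨f, hf, h2⟩
    exact h (f 0) (f 1) (f 2) (hf (by decide)) (hf (by decide)) ((h2 0 1).2 (by decide))
      ((h2 1 2).2 (by decide))

/-- 123-avoiding in elementary form. -/
def Av {n : ℕ} (σ : Equiv.Perm (Fin n)) : Prop :=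
  ∀ a b c, a < b → b < c → σ a < σ b → σ b < σ c → False

lemma anti_exists {k : ℕ} (R V : Finset (Fin k)) (h : R.card = V.card) :
    ∃ g : Fin k → Fin k, (∀ x ∈ R, g x ∈ V) ∧ (∀ x ∈ R, ∀ y ∈ R, x < y → g y < g x) := by
  classical
  refine ⟨fun x => if hx : x ∈ R then
    V.orderIsoOfFin h.symm (Fin.rev ((R.orderIsoOfFin rfl).symm ⟨x, hx⟩)) else x, ?_, ?_⟩
  · intro x hx
    simp only [hx, dif_pos]
    exact Subtype.property _
  · intro x hx y hy hxy
    simp only [hx, hy, dif_pos]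
    rw [Subtype.coe_lt_coe, OrderIso.lt_iff_lt, Fin.rev_lt_rev, OrderIso.lt_iff_lt]
    exact hxy

/-- lower-left empty -/
lemma ll_empty {n : ℕ} (σ : Equiv.Perm (Fin n)) (hσ : Av σ) (i : Fin n) (hi : σ i = i)
    (h2 : 2 * i.val + 1 ≤ n) (p : Fin n) (hp : p < i) : i < σ p := by
  classical
  by_contra hc
  have hlt : σ p < i := by
    rcases lt_or_eq_of_le (not_lt.1 hc) with h | h
    · exact h
    · rw [← hi] at h
      exact absurd (σ.injective h) hp.ne
  have hsub : (insert p (Finset.Ioi i)).image σ ⊆ Finset.Iio i := by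
    intro y hy
    simp only [Finset.mem_image, Finset.mem_insert, Finset.mem_Ioi, Finset.mem_Iio] at hy ⊢
    obtain ⟨x, hx | hx, rfl⟩ := hy
    · rw [hx]; exact hlt
    · by_contra hge
      have : i < σ x := by
        rcases lt_or_eq_of_le (not_lt.1 hge) with h | h
        · exact h
        · nth_rewrite 1 [← hi] at h
          exact absurd (σ.injective h) hx.ne
      exact hσ p i x hp hx (by rw [hi]; exact hlt) (by rw [hi]; exact this)
  have hcard := Finset.card_le_card hsub
  rw [Finset.card_image_of_injective _ σ.injective, Finset.card_insert_of_notMem (by simp [hp.le]),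
    Fin.card_Ioi, Fin.card_Iio] at hcard
  have := i.2
  omega

section decomposition
variable {i k : ℕ}

/-- the centre -/
def ctr (i k : ℕ) : Fin (i + 1 + k) := ⟨i, by omega⟩
/-- low indices -/
def lo (p : Fin i) : Fin (i + 1 + k) := ⟨p.val, by omega⟩
/-- high indices -/
def hi (p : Fin k) : Fin (i + 1 + k) := ⟨i + 1 + p.val, by omega⟩

lemma cases3 (x : Fin (i + 1 + k)) : (∃ p : Fin i, x = lo p) ∨ x = ctr i k ∨ ∃ p : Fin k, x = hi p := by
  rcases lt_trichotomy x.val i with h | h | h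
  · exact Or.inl ⟨⟨x.val, h⟩, rfl⟩
  · exact Or.inr (Or.inl (Fin.ext h))
  · refine Or.inr (Or.inr ⟨⟨x.val - (i + 1), by omega⟩, Fin.ext ?_⟩)
    simp only [hi]; omega

lemma lo_lt_lo (p q : Fin i) : (lo p : Fin (i + 1 + k)) < lo q ↔ p < q :=
  Iff.rfl
lemma hi_lt_hi (p q : Fin k) : (hi p : Fin (i + 1 + k)) < hi q ↔ p < q :=
  by rw [Fin.lt_def, Fin.lt_def]; simp only [hi]; omega
lemma lo_lt_ctr (p : Fin i) : (lo p : Fin (i + 1 + k)) < ctr i k := by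
  simp [lo, ctr, Fin.lt_def]
lemma ctr_lt_hi (p : Fin k) : ctr i k < hi p := by
  simp [hi, ctr, Fin.lt_def]; omega
lemma lo_lt_hi (p : Fin i) (q : Fin k) : (lo p : Fin (i + 1 + k)) < hi q :=
  (lo_lt_ctr p).trans (ctr_lt_hi q)
lemma lo_inj {p q : Fin i} (h : (lo p : Fin (i + 1 + k)) = lo q) : p = q := by
  simpa [lo, Fin.ext_iff] using h
lemma hi_inj {p q : Fin k} (h : (hi p : Fin (i + 1 + k)) = hi q) : p = q := by
  simpa [hi, Fin.ext_iff] using h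
lemma eq_hi_of_lt (x : Fin (i + 1 + k)) (h : ctr i k < x) : ∃ p : Fin k, x = hi p := by
  rcases cases3 x with ⟨p, rfl⟩ | rfl | h'
  · exact absurd h (lo_lt_ctr p).not_gt
  · exact absurd h (lt_irrefl _)
  · exact h'

/-- The structure of avoiders with a fixed left-to-right minimum, relationally. -/
def Dec (σ : Equiv.Perm (Fin (i + 1 + k))) (α β : Fin i → Fin k) : Prop :=
  σ (ctr i k) = ctr i k ∧ (∀ p, σ (lo p) = hi (α p)) ∧ (∀ v, σ (hi (β v)) = lo v)

lemma dec_exists (hik : i ≤ k) (σ : Equiv.Perm (Fin (i + 1 + k))) (hσ : Av σ)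
    (hc : σ (ctr i k) = ctr i k) : ∃ α β, Dec σ α β ∧ Good α ∧ Good β := by
  have hL : ∀ p : Fin i, ∃ a : Fin k, σ (lo p) = hi a := fun p =>
    eq_hi_of_lt _ (ll_empty σ hσ (ctr i k) hc (by simp [ctr]; omega) _ (lo_lt_ctr p))
  have hV : ∀ v : Fin i, ∃ a : Fin k, σ (hi a) = lo v := by
    intro v
    rcases cases3 (σ.symm (lo v)) with ⟨p, hp⟩ | hp | ⟨p, hp⟩
    · obtain ⟨a, ha⟩ := hL p
      rw [← hp, Equiv.apply_symm_apply] at ha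
      exact absurd ha (lo_lt_hi v a).ne
    · rw [Equiv.symm_apply_eq, hc] at hp
      exact absurd hp (lo_lt_ctr v).ne
    · exact ⟨p, by rw [← hp, Equiv.apply_symm_apply]⟩
  choose α hα using hL
  choose β hβ using hV
  refine ⟨α, β, ⟨hc, hα, hβ⟩, ⟨?_, ?_⟩, ⟨?_, ?_⟩⟩
  · intro a b h
    apply lo_inj (k := k)
    apply σ.injective
    rw [hα, hα, h]
  · intro p q hpq h y hy
    have hq : σ (lo q) < hi y := by rw [hα, hi_lt_hi]; exact hy
    have hle : ¬ lo q < σ.symm (hi y) := by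
      intro hlt
      refine hσ (lo p) (lo q) (σ.symm (hi y)) ((lo_lt_lo _ _).2 hpq) hlt ?_ ?_
      · rw [hα, hα, hi_lt_hi]; exact h
      · simpa using hq
    have hne : σ.symm (hi y) ≠ lo q := by
      intro e
      rw [← e] at hq
      simp at hq
    have hlt := lt_of_le_of_ne (not_lt.1 hle) hne
    rcases cases3 (σ.symm (hi y)) with ⟨r, hr⟩ | hr | ⟨r, hr⟩
    · refine ⟨r, ?_, ?_⟩
      · rw [hr, lo_lt_lo] at hlt; exact hlt
      · apply hi_inj (i := i)
        rw [← hα, ← hr]; simp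
    · rw [hr] at hlt; exact absurd hlt (lo_lt_ctr _).not_gt
    · rw [hr] at hlt; exact absurd hlt (lo_lt_hi _ _).not_gt
  · intro a b h
    apply lo_inj (k := k)
    rw [← hβ, ← hβ, h]
  · intro v w hvw h y hy
    have hle : ¬ lo w < σ (hi y) := by
      intro hlt
      refine hσ (hi (β v)) (hi (β w)) (hi y) ((hi_lt_hi _ _).2 h) ((hi_lt_hi _ _).2 hy) ?_ ?_
      · rw [hβ, hβ, lo_lt_lo]; exact hvw
      · rw [hβ]; exact hlt
    have hne : σ (hi y) ≠ lo w := by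
      rw [← hβ w]
      intro e
      exact hy.ne' (hi_inj (σ.injective e))
    have hlt := lt_of_le_of_ne (not_lt.1 hle) hne
    rcases cases3 (σ (hi y)) with ⟨r, hr⟩ | hr | ⟨r, hr⟩
    · refine ⟨r, ?_, ?_⟩
      · rw [hr, lo_lt_lo] at hlt; exact hlt
      · rw [← hβ r] at hr
        exact (hi_inj (σ.injective hr)).symm
    · rw [hr] at hlt; exact absurd hlt (lo_lt_ctr _).not_gt
    · rw [hr] at hlt; exact absurd hlt (lo_lt_hi _ _).not_gt

lemma dec_fun {σ : Equiv.Perm (Fin (i + 1 + k))} {α β α' β' : Fin i → Fin k}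
    (h : Dec σ α β) (h' : Dec σ α' β') : α = α' ∧ β = β' := by
  constructor
  · funext p
    apply hi_inj (i := i)
    rw [← h.2.1, ← h'.2.1]
  · funext v
    apply hi_inj (i := i)
    apply σ.injective
    rw [h.2.2, h'.2.2]

lemma dec_aux {σ τ : Equiv.Perm (Fin (i + 1 + k))} {α β : Fin i → Fin k}
    (hσ : Av σ) (h : Dec σ α β) (h' : Dec τ α β)
    (p : Fin k) (a b : Fin k) (ha : σ (hi p) = hi a) (hb : τ (hi p) = hi b) (hab : a < b)
    (ih : ∀ q < p, σ (hi q) = τ (hi q)) : False := by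
  rcases cases3 (σ.symm (hi b)) with ⟨r, hr⟩ | hr | ⟨r, hr⟩
  · have e : hi b = σ (lo r) := by rw [← hr]; simp
    rw [h.2.1, ← h'.2.1, ← hb] at e
    exact absurd (τ.injective e) (lo_lt_hi r p).ne'
  · have e : hi b = σ (ctr i k) := by rw [← hr]; simp
    rw [h.1] at e
    exact absurd e (ctr_lt_hi b).ne'
  · have e : hi b = σ (hi r) := by rw [← hr]; simp
    rcases lt_trichotomy r p with hlt | rfl | hgt
    · rw [ih r hlt, ← hb] at e
      exact hlt.ne' (hi_inj (τ.injective e))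
    · rw [ha] at e
      exact hab.ne' (hi_inj e)
    · refine hσ (ctr i k) (hi p) (hi r) (ctr_lt_hi _) ((hi_lt_hi _ _).2 hgt) ?_ ?_
      · rw [h.1, ha]; exact ctr_lt_hi _
      · rw [ha, ← e, hi_lt_hi]; exact hab

lemma dec_inj {σ τ : Equiv.Perm (Fin (i + 1 + k))} {α β : Fin i → Fin k}
    (hσ : Av σ) (hτ : Av τ) (h : Dec σ α β) (h' : Dec τ α β) : σ = τ := by
  have key : ∀ N : ℕ, ∀ p : Fin k, p.val = N → σ (hi p) = τ (hi p) := by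
    intro N
    induction N using Nat.strong_induction_on with
    | _ N ih =>
      rintro p rfl
      have ih' : ∀ q < p, σ (hi q) = τ (hi q) := fun q hq => ih q.val hq q rfl
      rcases cases3 (σ (hi p)) with ⟨v, hv⟩ | hv | ⟨a, ha⟩
      · have : hi p = (hi (β v) : Fin (i + 1 + k)) := σ.injective (by rw [hv, h.2.2])
        rw [this, h.2.2, h'.2.2]
      · rw [← h.1] at hv
        exact absurd (σ.injective hv) (ctr_lt_hi _).ne'
      rcases cases3 (τ (hi p)) with ⟨v, hv⟩ | hv | ⟨b, hb⟩
      · have : hi p = (hi (β v) : Fin (i + 1 + k)) := τ.injective (by rw [hv, h'.2.2])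
        rw [this, h.2.2, h'.2.2]
      · rw [← h'.1] at hv
        exact absurd (τ.injective hv) (ctr_lt_hi _).ne'
      rcases lt_trichotomy a b with hab | rfl | hab
      · exact (dec_aux hσ h h' p a b ha hb hab ih').elim
      · rw [ha, hb]
      · exact (dec_aux hτ h' h p b a hb ha hab (fun q hq => (ih' q hq).symm)).elim
  ext x : 1
  rcases cases3 x with ⟨p, rfl⟩ | rfl | ⟨p, rfl⟩
  · rw [h.2.1, h'.2.1]
  · rw [h.1, h'.1]
  · exact key _ p rfl

lemma dec_surj (α β : Fin i → Fin k) (hα : Good α) (hβ : Good β) :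
    ∃ σ : Equiv.Perm (Fin (i + 1 + k)), Av σ ∧ Dec σ α β := by
  classical
  obtain ⟨g, hg1, hg2⟩ := anti_exists (Finset.univ \ Finset.univ.image β)
    (Finset.univ \ Finset.univ.image α) (by
      rw [Finset.card_sdiff_of_subset (Finset.subset_univ _),
        Finset.card_sdiff_of_subset (Finset.subset_univ _),
        Finset.card_image_of_injective _ hα.1, Finset.card_image_of_injective _ hβ.1])
  simp only [Finset.mem_sdiff, Finset.mem_univ, true_and, Finset.mem_image, not_exists] at hg1 hg2
  let F : Fin (i + 1 + k) → Fin (i + 1 + k) := fun x =>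
    if h : x.val < i then hi (α ⟨x.val, h⟩) else
    if h' : x.val = i then ctr i k else
    if h'' : ∃ v, β v = ⟨x.val - (i + 1), by omega⟩ then lo h''.choose else
      hi (g ⟨x.val - (i + 1), by omega⟩)
  have F1 : ∀ p, F (lo p) = hi (α p) := by
    intro p
    simp [F, lo]
  have F2 : F (ctr i k) = ctr i k := by simp [F, ctr]
  have F3 : ∀ v, F (hi (β v)) = lo v := by
    intro v
    have e : ∃ w, β w = β v := ⟨v, rfl⟩
    have e1 : ¬ (i + 1 + (β v).val < i) := by omega
    have e2 : ¬ (i + 1 + (β v).val = i) := by omega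
    simp only [F, hi, e1, e2, dif_neg, not_false_eq_true, Nat.add_sub_cancel_left, Fin.eta]
    rw [dif_pos e]
    congr 1
    exact hβ.1 e.choose_spec
  have F4 : ∀ p, (∀ v, β v ≠ p) → F (hi p) = hi (g p) := by
    intro p hp
    have e : ¬ ∃ w, β w = p := by push Not; exact hp
    have e1 : ¬ (i + 1 + p.val < i) := by omega
    have e2 : ¬ (i + 1 + p.val = i) := by omega
    simp only [F, hi, e1, e2, dif_neg, not_false_eq_true, Nat.add_sub_cancel_left, Fin.eta, e]
  have c4 : ∀ x : Fin (i + 1 + k), (∃ p : Fin i, x = lo p) ∨ x = ctr i k ∨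
      (∃ v, x = hi (β v)) ∨ ∃ p : Fin k, (∀ v, β v ≠ p) ∧ x = hi p := by
    intro x
    rcases cases3 x with h | h | ⟨p, rfl⟩
    · exact Or.inl h
    · exact Or.inr (Or.inl h)
    · by_cases hp : ∃ v, β v = p
      · obtain ⟨v, rfl⟩ := hp
        exact Or.inr (Or.inr (Or.inl ⟨v, rfl⟩))
      · push Not at hp
        exact Or.inr (Or.inr (Or.inr ⟨p, hp, rfl⟩))
  have ginj : ∀ p q, (∀ v, β v ≠ p) → (∀ v, β v ≠ q) → g p = g q → p = q := by
    intro p q hp hq e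
    rcases lt_trichotomy p q with h | h | h
    · exact absurd e (hg2 p hp q hq h).ne'
    · exact h
    · exact absurd e (hg2 q hq p hp h).ne
  have Finj : Function.Injective F := by
    intro x y hxy
    rcases c4 x with ⟨p, rfl⟩ | rfl | ⟨p, rfl⟩ | ⟨p, hp, rfl⟩ <;>
    rcases c4 y with ⟨q, rfl⟩ | rfl | ⟨q, rfl⟩ | ⟨q, hq, rfl⟩ <;>
    (try simp only [F1, F2, F3] at hxy) <;> (try rw [F4 _ hp] at hxy) <;> (try rw [F4 _ hq] at hxy)
    · rw [hα.1 (hi_inj hxy)]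
    · exact absurd hxy (ctr_lt_hi _).ne'
    · exact absurd hxy (lo_lt_hi _ _).ne'
    · exact absurd (hi_inj hxy) (hg1 q hq p)
    · exact absurd hxy (ctr_lt_hi _).ne
    · rfl
    · exact absurd hxy (lo_lt_ctr _).ne'
    · exact absurd hxy (ctr_lt_hi _).ne
    · exact absurd hxy (lo_lt_hi _ _).ne
    · exact absurd hxy (lo_lt_ctr _).ne
    · rw [lo_inj hxy]
    · exact absurd hxy (lo_lt_hi _ _).ne
    · exact absurd (hi_inj hxy).symm (hg1 p hp q)
    · exact absurd hxy (ctr_lt_hi _).ne'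
    · exact absurd hxy (lo_lt_hi _ _).ne'
    · rw [ginj p q hp hq (hi_inj hxy)]
  refine ⟨Equiv.ofBijective F (Finite.injective_iff_bijective.1 Finj), ?_, F2, F1, F3⟩
  intro a b c hab hbc h1 h2
  simp only [Equiv.ofBijective_apply] at h1 h2
  -- two increasing upper-right points are impossible
  have UR : ∀ x y, ctr i k < x → x < y → ctr i k < F x → F x < F y → False := by
    intro x y hx hxy hFx hFxy
    rcases c4 x with ⟨p, rfl⟩ | rfl | ⟨p, rfl⟩ | ⟨p, hp, rfl⟩
    · exact absurd hx (lo_lt_ctr _).not_gt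
    · exact absurd hx (lt_irrefl _)
    · rw [F3] at hFx; exact absurd hFx (lo_lt_ctr _).not_gt
    have hFy := hFx.trans hFxy
    rcases c4 y with ⟨q, rfl⟩ | rfl | ⟨q, rfl⟩ | ⟨q, hq, rfl⟩
    · exact absurd (hx.trans hxy) (lo_lt_ctr _).not_gt
    · exact absurd (hx.trans hxy) (lt_irrefl _)
    · rw [F3] at hFy; exact absurd hFy (lo_lt_ctr _).not_gt
    rw [F4 _ hp, F4 _ hq, hi_lt_hi] at hFxy
    exact absurd hFxy (hg2 p hp q hq ((hi_lt_hi _ _).1 hxy)).not_gt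
  by_cases hb : ctr i k < b ∧ ctr i k < F b
  · exact UR b c hb.1 hbc hb.2 h2
  rcases c4 a with ⟨p, rfl⟩ | rfl | ⟨p, rfl⟩ | ⟨p, hp, rfl⟩
  · rw [F1] at h1
    rcases c4 b with ⟨q, rfl⟩ | rfl | ⟨q, rfl⟩ | ⟨q, hq, rfl⟩
    · rw [F1] at h1 h2
      obtain ⟨y, hy⟩ := eq_hi_of_lt _ ((ctr_lt_hi _).trans h2)
      rw [hy, hi_lt_hi] at h2
      rw [hi_lt_hi] at h1
      obtain ⟨r, hr, e⟩ := hα.2 p q ((lo_lt_lo _ _).1 hab) h1 y h2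
      rw [← e, ← F1] at hy
      rw [Finj hy, lo_lt_lo] at hbc
      exact absurd hbc hr.not_gt
    · rw [F2] at h1; exact absurd h1 (ctr_lt_hi _).not_gt
    · rw [F3] at h1; exact absurd h1 (lo_lt_hi _ _).not_gt
    · exact hb ⟨ctr_lt_hi _, (ctr_lt_hi _).trans h1⟩
  · exact hb ⟨hab, by rwa [F2] at h1⟩
  · rcases c4 b with ⟨q, rfl⟩ | rfl | ⟨q, rfl⟩ | ⟨q, hq, rfl⟩
    · exact absurd hab (lo_lt_hi _ _).not_gt
    · exact absurd hab (ctr_lt_hi _).not_gt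
    · rw [F3] at h1 h2
      rw [F3] at h1
      obtain ⟨y, rfl⟩ := eq_hi_of_lt _ ((ctr_lt_hi _).trans hbc)
      obtain ⟨r, hr, rfl⟩ := hβ.2 p q ((lo_lt_lo _ _).1 h1) ((hi_lt_hi _ _).1 hab) y
        ((hi_lt_hi _ _).1 hbc)
      rw [F3, lo_lt_lo] at h2
      exact absurd hr h2.not_gt
    · exact hb ⟨ctr_lt_hi _, by rw [F4 _ hq]; exact ctr_lt_hi _⟩
  · rw [F4 _ hp] at h1
    exact hb ⟨(ctr_lt_hi _).trans hab, (ctr_lt_hi _).trans h1⟩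

open Classical in
lemma count_low (hik : i ≤ k) :
    (Finset.univ.filter (fun σ : Equiv.Perm (Fin (i + 1 + k)) =>
      Av σ ∧ σ (ctr i k) = ctr i k)).card = NN k i ^ 2 := by
  have hex : ∀ σ : Equiv.Perm (Fin (i + 1 + k)), (Av σ ∧ σ (ctr i k) = ctr i k) →
      ∃ ab : (Fin i → Fin k) × (Fin i → Fin k), Dec σ ab.1 ab.2 ∧ Good ab.1 ∧ Good ab.2 := by
    intro σ h
    obtain ⟨α, β, h⟩ := dec_exists hik σ h.1 h.2
    exact ⟨(α, β), h⟩
  rw [sq]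
  unfold NN
  rw [← Finset.card_product]
  apply Finset.card_bij (fun σ hσ => (hex σ (by simpa using hσ)).choose)
  · intro σ hσ
    have := (hex σ (by simpa using hσ)).choose_spec
    simp only [Finset.mem_product, Finset.mem_filter, Finset.mem_univ, true_and]
    exact this.2
  · intro σ hσ τ hτ e
    have h1 := (hex σ (by simpa using hσ)).choose_spec.1
    have h2 := (hex τ (by simpa using hτ)).choose_spec.1
    rw [e] at h1
    simp only [Finset.mem_filter, Finset.mem_univ, true_and] at hσ hτ
    exact dec_inj hσ.1 hτ.1 h1 h2
  · rintro ⟨α, β⟩ hab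
    simp only [Finset.mem_product, Finset.mem_filter, Finset.mem_univ, true_and] at hab
    obtain ⟨σ, h1, h2⟩ := dec_surj α β hab.1 hab.2
    have hσ : Av σ ∧ σ (ctr i k) = ctr i k := ⟨h1, h2.1⟩
    refine ⟨σ, by simpa using hσ, ?_⟩
    have h3 := (hex σ hσ).choose_spec.1
    have := dec_fun h3 h2
    exact Prod.ext this.1 this.2

end decomposition

open Classical in
/-- Number of avoiders fixing `x`. -/
noncomputable def DD (n : ℕ) (x : Fin n) : ℕ :=
  (Finset.univ.filter (fun σ : Equiv.Perm (Fin n) => Av σ ∧ σ x = x)).card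

lemma DD_low (n i : ℕ) (h : i < n) (h2 : 2 * i + 1 ≤ n) : DD n ⟨i, h⟩ = NN (n - 1 - i) i ^ 2 := by
  obtain ⟨k, rfl⟩ : ∃ k, n = i + 1 + k := ⟨n - (i + 1), by omega⟩
  have : i + 1 + k - 1 - i = k := by omega
  rw [this, ← count_low (by omega)]
  rfl

lemma Av_rev {n : ℕ} (σ : Equiv.Perm (Fin n)) (h : Av σ) :
    Av ((Fin.revPerm : Equiv.Perm (Fin n)).permCongr σ) := by
  intro a b c hab hbc h1 h2
  simp only [Equiv.permCongr_apply, Fin.revPerm_symm, Fin.revPerm_apply, Fin.rev_lt_rev] at h1 h2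
  exact h (Fin.rev c) (Fin.rev b) (Fin.rev a) (Fin.rev_lt_rev.2 hbc) (Fin.rev_lt_rev.2 hab) h2 h1

lemma DD_rev (n : ℕ) (x : Fin n) : DD n (Fin.rev x) = DD n x := by
  classical
  unfold DD
  have inv : ∀ σ : Equiv.Perm (Fin n), (Fin.revPerm : Equiv.Perm (Fin n)).permCongr
      ((Fin.revPerm : Equiv.Perm (Fin n)).permCongr σ) = σ := by
    intro σ
    ext y
    simp [Equiv.permCongr_apply]
  apply Finset.card_nbij' (fun σ => (Fin.revPerm : Equiv.Perm (Fin n)).permCongr σ)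
    (fun σ => (Fin.revPerm : Equiv.Perm (Fin n)).permCongr σ)
  · intro σ hσ
    simp only [Finset.coe_filter, Finset.mem_univ, true_and, Set.mem_ofPred_eq] at hσ ⊢
    refine ⟨Av_rev σ hσ.1, ?_⟩
    simp [Equiv.permCongr_apply, hσ.2]
  · intro σ hσ
    simp only [Finset.coe_filter, Finset.mem_univ, true_and, Set.mem_ofPred_eq] at hσ ⊢
    refine ⟨Av_rev σ hσ.1, ?_⟩
    simp [Equiv.permCongr_apply, hσ.2]
  · intro σ _; exact inv σ
  · intro σ _; exact inv σ

/-- Ballot numbers, antisymmetrically extended. -/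
def bb (m : ℕ) : ℕ → ℤ
  | 0 => 1
  | j + 1 => (m.choose (j + 1) : ℤ) - m.choose j

lemma NN_bb (m j : ℕ) (h : 2 * j ≤ m) : (NN (m - j) j : ℤ) = bb m j := by
  cases j with
  | zero => simp [NN_zero, bb]
  | succ j =>
    have := NN_formula (m - (j + 1)) j (by omega)
    have e : m - (j + 1) + j + 1 = m := by omega
    rw [e] at this
    simp only [bb]
    omega

lemma bb_symm (m j : ℕ) (h : j ≤ m) : bb m (m + 1 - j) ^ 2 = bb m j ^ 2 := by
  cases j with
  | zero => simp [bb]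
  | succ j =>
    have e : m + 1 - (j + 1) = (m - (j + 1)) + 1 := by omega
    have e2 : m - (j + 1) + 1 = m - j := by omega
    rw [e]
    simp only [bb]
    rw [e2, Nat.choose_symm (by omega : j ≤ m), Nat.choose_symm h]
    ring

lemma sum_bb_sq (m : ℕ) : ∑ j ∈ Finset.range (m + 2), bb m j ^ 2 = 2 * (catalan m : ℤ) := by
  have h1 : ∑ j ∈ Finset.range (m + 1), ((m.choose j : ℤ)) ^ 2 = (Nat.centralBinom m : ℤ) := by
    rw [Nat.centralBinom, ← Nat.sum_range_choose_sq]; push_cast; rfl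
  have h1' : ∑ j ∈ Finset.range (m + 1), ((m.choose (j + 1) : ℤ)) ^ 2
      = (Nat.centralBinom m : ℤ) - 1 := by
    have := Finset.sum_range_succ' (fun j => ((m.choose j : ℤ)) ^ 2) (m + 1)
    rw [Finset.sum_range_succ, h1] at this
    simp at this
    linarith
  have h2 : ∑ j ∈ Finset.range (m + 2), (((m + 1).choose j : ℤ)) ^ 2
      = (Nat.centralBinom (m + 1) : ℤ) := by
    rw [Nat.centralBinom, ← Nat.sum_range_choose_sq]; push_cast; rfl
  rw [Finset.sum_range_succ'] at h2 ⊢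
  simp only [bb]
  have h3 : ∀ j, ((m.choose (j + 1) : ℤ) - m.choose j) ^ 2
      = 2 * ((m.choose (j + 1) : ℤ)) ^ 2 + 2 * (m.choose j : ℤ) ^ 2
        - ((m + 1).choose (j + 1) : ℤ) ^ 2 := by
    intro j
    rw [Nat.choose_succ_succ']; push_cast; ring
  simp only [h3, Finset.sum_sub_distrib, Finset.sum_add_distrib, ← Finset.mul_sum, h1, h1']
  simp only [Nat.choose_zero_right] at h2
  have h4 := Nat.succ_mul_centralBinom_succ m
  have h5 := succ_mul_catalan_eq_centralBinom m
  have h4' : ((m : ℤ) + 1) * Nat.centralBinom (m + 1) = 2 * (2 * m + 1) * Nat.centralBinom m := by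
    exact_mod_cast h4
  have h5' : ((m : ℤ) + 1) * catalan m = Nat.centralBinom m := by exact_mod_cast h5
  have h6 : ((m : ℤ) + 1) ≠ 0 := by positivity
  apply mul_left_cancel₀ h6
  push_cast at h2
  have h7 : ∑ j ∈ Finset.range (m + 1), (((m + 1).choose (j + 1) : ℤ)) ^ 2
      = (Nat.centralBinom (m + 1) : ℤ) - 1 := by linarith
  rw [h7]
  linear_combination (-1) * h4' - 2 * h5'

lemma sum_DD (m : ℕ) : (∑ x : Fin (m + 1), (DD (m + 1) x : ℤ))
    = 2 * (catalan m : ℤ) - bb m (m / 2 + 1) ^ 2 := by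
  have hlow : ∀ i (h : i < m + 1), 2 * i ≤ m → (DD (m + 1) ⟨i, h⟩ : ℤ) = bb m i ^ 2 := by
    intro i h hi
    rw [DD_low _ _ h (by omega), ← NN_bb m i hi]
    push_cast; rfl
  have hhigh : ∀ i (h : i < m + 1), m ≤ 2 * i → (DD (m + 1) ⟨i, h⟩ : ℤ) = bb m (i + 1) ^ 2 := by
    intro i h hi
    rw [← DD_rev]
    have : Fin.rev (⟨i, h⟩ : Fin (m + 1)) = ⟨m - i, by omega⟩ := by
      ext; simp
    have e : i + 1 = m + 1 - (m - i) := by omega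
    rw [this, hlow _ _ (by omega), e, bb_symm m (m - i) (by omega)]
  have e1 : (∑ x : Fin (m + 1), (DD (m + 1) x : ℤ))
      = ∑ i ∈ Finset.range (m + 1), (if i < m / 2 + 1 then bb m i ^ 2 else bb m (i + 1) ^ 2) := by
    rw [← Fin.sum_univ_eq_sum_range (fun i => if i < m / 2 + 1 then bb m i ^ 2 else bb m (i + 1) ^ 2)]
    apply Finset.sum_congr rfl
    rintro ⟨i, h⟩ _
    split_ifs with hc
    · exact hlow i h (by simp only at hc; omega)
    · exact hhigh i h (by simp only at hc; omega)
  rw [e1, ← sum_bb_sq]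
  obtain ⟨t, ht⟩ : ∃ t, m = m / 2 + t := ⟨m - m / 2, by omega⟩
  have a1 : m + 1 = (m / 2 + 1) + t := by omega
  have a2 : m + 2 = (m / 2 + 1) + (t + 1) := by omega
  rw [a1, a2, Finset.sum_range_add _ (m / 2 + 1) t, Finset.sum_range_add _ (m / 2 + 1) (t + 1), Finset.sum_range_succ' _ t]
  have b1 : ∑ i ∈ Finset.range (m / 2 + 1), (if i < m / 2 + 1 then bb m i ^ 2 else bb m (i + 1) ^ 2)
      = ∑ i ∈ Finset.range (m / 2 + 1), bb m i ^ 2 := by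
    apply Finset.sum_congr rfl
    intro i hi
    rw [if_pos (Finset.mem_range.1 hi)]
  have b2 : ∀ j, (if m / 2 + 1 + j < m / 2 + 1 then bb m (m / 2 + 1 + j) ^ 2
      else bb m (m / 2 + 1 + j + 1) ^ 2) = bb m (m / 2 + 1 + (j + 1)) ^ 2 := by
    intro j
    rw [if_neg (by omega)]; rfl
  rw [b1]
  simp only [b2]
  simp only [add_zero]
  ring

lemma bb_mid (m : ℕ) : ((m / 2 + 1 : ℕ) : ℤ) ^ 2 * bb m (m / 2 + 1) ^ 2 ≤ Nat.centralBinom m := by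
  rcases Nat.even_or_odd' m with ⟨h, rfl | rfl⟩
  · have e : 2 * h / 2 = h := by omega
    rw [e]
    have h1 := Nat.choose_succ_right_eq (2 * h) h
    have e2 : 2 * h - h = h := by omega
    rw [e2] at h1
    have h1' : ((2 * h).choose (h + 1) : ℤ) * (h + 1) = (2 * h).choose h * h := by exact_mod_cast h1
    have h2 : (2 * h).choose h ^ 2 ≤ Nat.centralBinom (2 * h) := by
      rw [Nat.centralBinom, ← Nat.sum_range_choose_sq (2 * h)]
      refine Finset.single_le_sum (a := h) (f := fun j => (2 * h).choose j ^ 2) (fun _ _ => Nat.zero_le _)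
        (Finset.mem_range.2 (by omega : h < 2 * h + 1))
    have h2' : ((2 * h).choose h : ℤ) ^ 2 ≤ Nat.centralBinom (2 * h) := by exact_mod_cast h2
    simp only [bb]
    refine le_trans (le_of_eq ?_) h2'
    rw [← mul_pow]
    have : (((h + 1 : ℕ) : ℤ) * (((2 * h).choose (h + 1) : ℤ) - (2 * h).choose h))
        = - ((2 * h).choose h : ℤ) := by
      push_cast
      linear_combination h1'
    rw [this]; ring
  · have e : (2 * h + 1) / 2 = h := by omega
    rw [e]
    have : (2 * h + 1).choose (h + 1) = (2 * h + 1).choose h :=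
      Nat.choose_symm_of_eq_add (by omega)
    simp [bb, this]

lemma sum_fp (n : ℕ) :
    ∑ σ ∈ Finset.univ.filter (fun σ : Equiv.Perm (Fin n) => Avoids σ pattern123), (fpCount σ : ℝ)
      = ((∑ x : Fin n, (DD n x : ℤ) : ℤ) : ℝ) := by
  have : ∑ σ ∈ Finset.univ.filter (fun σ : Equiv.Perm (Fin n) => Avoids σ pattern123), fpCount σ
      = ∑ x : Fin n, DD n x := by
    unfold fpCount DD
    simp only [Finset.card_filter]
    rw [Finset.sum_comm]
    apply Finset.sum_congr rfl
    intro x _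
    rw [Finset.sum_filter]
    apply Finset.sum_congr rfl
    intro σ _
    have h : Avoids σ pattern123 ↔ Av σ := avoids_iff σ
    by_cases h1 : Av σ <;> by_cases h2 : σ x = x <;> simp [h, h1, h2]
  exact_mod_cast this

/-- The expected number of fixed points of a uniformly random `123`-avoiding
permutation of size `n` tends to `1/2`. -/
theorem expected_fixed_points_123 :
    Tendsto (fun n : ℕ =>
        (1 / (catalan n : ℝ)) *
          ∑ σ ∈ Finset.univ.filter (fun σ : Equiv.Perm (Fin n) => Avoids σ pattern123),
            (fpCount σ : ℝ))
      atTop (nhds (1 / 2)) := by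
  rw [← tendsto_add_atTop_iff_nat 1]
  have hinv : Tendsto (fun m : ℕ => 1 / ((m : ℝ) + 1)) atTop (nhds 0) :=
    tendsto_one_div_add_atTop_nhds_zero_nat
  have hinv0 : Tendsto (fun m : ℕ => ((m : ℝ))⁻¹) atTop (nhds 0) :=
    tendsto_inv_atTop_nhds_zero_nat
  have hmain : Tendsto (fun m : ℕ => ((m : ℝ) + 2) / (2 * m + 1)) atTop (nhds (1 / 2)) := by
    have h : Tendsto (fun m : ℕ => (1 + 2 * ((m : ℝ))⁻¹) / (2 + ((m : ℝ))⁻¹)) atTop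
        (nhds ((1 + 2 * 0) / (2 + 0))) :=
      (tendsto_const_nhds.add (hinv0.const_mul 2)).div (tendsto_const_nhds.add hinv0) (by norm_num)
    have e : ((1 : ℝ) + 2 * 0) / (2 + 0) = 1 / 2 := by norm_num
    rw [e] at h
    refine h.congr' ?_
    filter_upwards [eventually_gt_atTop 0] with m hm
    have : (m : ℝ) ≠ 0 := by positivity
    field_simp
  have hlower : Tendsto (fun m : ℕ => ((m : ℝ) + 2) / (2 * m + 1) - 4 * (1 / ((m : ℝ) + 1))) atTop
      (nhds (1 / 2)) := by
    have := hmain.sub (hinv.const_mul 4)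
    simpa using this
  have key : ∀ m : ℕ, (1 / (catalan (m + 1) : ℝ)) *
      ∑ σ ∈ Finset.univ.filter (fun σ : Equiv.Perm (Fin (m + 1)) => Avoids σ pattern123),
        (fpCount σ : ℝ) = ((m : ℝ) + 2) / (2 * m + 1) -
          (bb m (m / 2 + 1) : ℝ) ^ 2 * ((m + 1) * (m + 2) / (2 * (2 * m + 1) * Nat.centralBinom m)) := by
    intro m
    rw [sum_fp, sum_DD]
    have h4 : ((m : ℝ) + 1) * Nat.centralBinom (m + 1) = 2 * (2 * m + 1) * Nat.centralBinom m := by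
      exact_mod_cast Nat.succ_mul_centralBinom_succ m
    have h5 : ((m : ℝ) + 1) * catalan m = Nat.centralBinom m := by
      exact_mod_cast succ_mul_catalan_eq_centralBinom m
    have h6 : ((m : ℝ) + 1 + 1) * catalan (m + 1) = Nat.centralBinom (m + 1) := by
      exact_mod_cast succ_mul_catalan_eq_centralBinom (m + 1)
    have hpos : (0 : ℝ) < Nat.centralBinom m := by exact_mod_cast Nat.centralBinom_pos m
    have c1 : (catalan m : ℝ) = Nat.centralBinom m / (m + 1) := by
      rw [← h5]; field_simp
    have c2 : (catalan (m + 1) : ℝ) = 2 * (2 * m + 1) * Nat.centralBinom m / ((m + 1) * (m + 2)) := by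
      rw [← h4, ← h6]; field_simp; ring
    push_cast
    rw [c2, c1]
    field_simp
  have hnn : ∀ m : ℕ, 0 ≤ (bb m (m / 2 + 1) : ℝ) ^ 2 *
      ((m + 1) * (m + 2) / (2 * (2 * m + 1) * Nat.centralBinom m)) := by
    intro m; positivity
  have hbd : ∀ m : ℕ, (bb m (m / 2 + 1) : ℝ) ^ 2 *
      ((m + 1) * (m + 2) / (2 * (2 * m + 1) * Nat.centralBinom m)) ≤ 4 * (1 / ((m : ℝ) + 1)) := by
    intro m
    have hpos : (0 : ℝ) < Nat.centralBinom m := by exact_mod_cast Nat.centralBinom_pos m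
    have h1 : (((m / 2 + 1 : ℕ)) : ℝ) ^ 2 * (bb m (m / 2 + 1) : ℝ) ^ 2 ≤ Nat.centralBinom m := by
      have := (Int.cast_le (R := ℝ)).2 (bb_mid m)
      push_cast at this ⊢
      exact this
    have h2 : ((m : ℝ) + 1) ≤ 2 * ((m / 2 + 1 : ℕ) : ℝ) := by
      have : m + 1 ≤ 2 * (m / 2 + 1) := by omega
      exact_mod_cast this
    set B := (bb m (m / 2 + 1) : ℝ) ^ 2 with hB
    have hB0 : 0 ≤ B := by positivity
    have h3 : ((m : ℝ) + 1) ^ 2 ≤ 4 * (((m / 2 + 1 : ℕ)) : ℝ) ^ 2 := by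
      have h0 : (0 : ℝ) ≤ (m : ℝ) + 1 := by positivity
      nlinarith
    have h4 : ((m : ℝ) + 1) ^ 2 * B ≤ 4 * Nat.centralBinom m := by nlinarith
    rw [← mul_div_assoc, mul_one_div, div_le_div_iff₀ (by positivity) (by positivity)]
    have h5 : ((m : ℝ) + 2) * (((m : ℝ) + 1) ^ 2 * B) ≤ ((m : ℝ) + 2) * (4 * Nat.centralBinom m) :=
      mul_le_mul_of_nonneg_left h4 (by positivity)
    have h6 : (0 : ℝ) ≤ m * Nat.centralBinom m := by positivity
    nlinarith
  refine tendsto_of_tendsto_of_tendsto_of_le_of_le hlower hmain ?_ ?_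
  · intro m
    simp only [key]
    linarith [hbd m]
  · intro m
    simp only [key]
    linarith [hnn m]
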